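/- arXiv:quant-ph/0610199 — 3 statements merged into one kernel-verified Lean document; each statement's English description precedes it below -/
import Mathlib

section
/- Let ρ be a density matrix on ℂ^d (a positive semidefinite complex d×d matrix of trace 1), let ω be a Hermitian d×d complex matrix, and let γ be a real number. Then Tr[{ρ − e^{γ} ω ≥ 0} ω] ≤ e^{−γ}. -/
open Matrix Kronecker ComplexOrder

noncomputable section

/-- Spectral projection `{C ≥ 0}` onto the span of eigenvectors with nonnegative
eigenvalues of a Hermitian matrix `C` (junk value `0` if `C` is not Hermitian). -/
def specProjNonneg {n : Type*} [Fintype n] [DecidableEq n] (C : Matrix n n ℂ) :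
    Matrix n n ℂ :=
  if h : C.IsHermitian then
    (h.eigenvectorUnitary : Matrix n n ℂ) *
      Matrix.diagonal (fun i => if 0 ≤ h.eigenvalues i then (1 : ℂ) else 0) *
      star (h.eigenvectorUnitary : Matrix n n ℂ)
  else 0

/-- Trace of the positive part `C⁺` of a Hermitian matrix `C`, i.e. the sum of its
nonnegative eigenvalues (junk value `0` if `C` is not Hermitian). -/
def posPartTrace {n : Type*} [Fintype n] [DecidableEq n] (C : Matrix n n ℂ) : ℝ :=
  if h : C.IsHermitian then ∑ i, max (h.eigenvalues i) 0 else 0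

/-- `⟨ψ| X |ψ⟩`, conjugate-linear in the first argument. -/
def overlap {n : Type*} [Fintype n] (ψ : n → ℂ) (X : Matrix n n ℂ) : ℂ :=
  star ψ ⬝ᵥ X *ᵥ ψ

/-- `⟨φ| X |ψ⟩`, conjugate-linear in the first argument. -/
def sandwich {n : Type*} [Fintype n] (φ : n → ℂ) (X : Matrix n n ℂ) (ψ : n → ℂ) : ℂ :=
  star φ ⬝ᵥ X *ᵥ ψ

/-- The maximally entangled state `|Ψ⁺_M⟩ = (1/√M) ∑_{i<M} e_i ⊗ e_i` in `ℂ^dA ⊗ ℂ^dB`. -/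
def maxEnt (dA dB M : ℕ) : Fin dA × Fin dB → ℂ :=
  fun p => if (p.1 : ℕ) = (p.2 : ℕ) ∧ (p.1 : ℕ) < M then ((Real.sqrt M : ℂ))⁻¹ else 0

theorem re_trace_specProjNonneg_mul {n : Type*} [Fintype n] [DecidableEq n]
    {C : Matrix n n ℂ} (hC : C.IsHermitian) (X : Matrix n n ℂ) :
    (specProjNonneg C * X).trace.re = ∑ i, if 0 ≤ hC.eigenvalues i then
      ((star (hC.eigenvectorUnitary : Matrix n n ℂ) * X * hC.eigenvectorUnitary) i i).re
      else 0 := by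
  rw [specProjNonneg, dif_pos hC, Matrix.mul_assoc, Matrix.mul_assoc, Matrix.trace_mul_comm,
    Matrix.mul_assoc, Matrix.trace, Complex.re_sum]
  refine Finset.sum_congr rfl fun i _ => ?_
  rw [Matrix.diag_apply, Matrix.diagonal_mul]
  split_ifs <;> simp

/-- The spectral projection onto the nonnegative part of `C` has nonnegative trace against `C`. -/
theorem re_trace_specProjNonneg_mul_self_nonneg {n : Type*} [Fintype n] [DecidableEq n]
    {C : Matrix n n ℂ} (hC : C.IsHermitian) : 0 ≤ (specProjNonneg C * C).trace.re := by
  have hdiag : star (hC.eigenvectorUnitary : Matrix n n ℂ) * C *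
        (hC.eigenvectorUnitary : Matrix n n ℂ) =
      diagonal (RCLike.ofReal ∘ hC.eigenvalues) := by
    simpa [Unitary.conjStarAlgAut_apply] using hC.conjStarAlgAut_star_eigenvectorUnitary
  rw [re_trace_specProjNonneg_mul hC, hdiag]
  refine Finset.sum_nonneg fun i _ => ?_
  split_ifs with h <;> simp [h]

theorem re_trace_specProjNonneg_mul_le {n : Type*} [Fintype n] [DecidableEq n]
    {C X : Matrix n n ℂ} (hC : C.IsHermitian) (hX : X.PosSemidef) :
    (specProjNonneg C * X).trace.re ≤ X.trace.re := by
  have htr : X.trace =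
      (star (hC.eigenvectorUnitary : Matrix n n ℂ) * X * hC.eigenvectorUnitary).trace := by
    rw [Matrix.trace_mul_cycle, Unitary.mul_star_self_of_mem hC.eigenvectorUnitary.2, Matrix.one_mul]
  rw [re_trace_specProjNonneg_mul hC, htr, Matrix.trace, Complex.re_sum]
  refine Finset.sum_le_sum fun i _ => ?_
  have h := (hX.conjTranspose_mul_mul_same (hC.eigenvectorUnitary : Matrix n n ℂ)).diag_nonneg
    (i := i)
  split_ifs
  · rfl
  · exact (Complex.nonneg_iff.mp h).1

/-- For a density matrix `ρ`, a Hermitian matrix `ω` and `γ : ℝ`,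
`Tr[{ρ − e^γ ω ≥ 0} ω] ≤ e^{−γ}`. -/
theorem stmt2 {d : ℕ} (ρ ω : Matrix (Fin d) (Fin d) ℂ)
    (hρ : ρ.PosSemidef) (hρtr : ρ.trace = 1) (hω : ω.IsHermitian) (γ : ℝ) :
    ((specProjNonneg (ρ - (Real.exp γ : ℂ) • ω) * ω).trace).re ≤ Real.exp (-γ) := by
  have hC : (ρ - (Real.exp γ : ℂ) • ω).IsHermitian :=
    hρ.1.sub (hω.smul (Complex.conj_ofReal _))
  have hnonneg := re_trace_specProjNonneg_mul_self_nonneg hC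
  have hle := re_trace_specProjNonneg_mul_le hC hρ
  rw [Matrix.mul_sub, Matrix.mul_smul, Matrix.trace_sub, Matrix.trace_smul, smul_eq_mul,
    Complex.sub_re, Complex.re_ofReal_mul] at hnonneg
  rw [hρtr, Complex.one_re] at hle
  rw [Real.exp_neg, ← one_div, le_div_iff₀' (Real.exp_pos γ)]
  linarith

end
end

section
/- Let ρ and σ be density matrices on ℂ^{d_A} ⊗ ℂ^{d_B}, let T(X) = ∑_k K_k X K_k† be a CPTP map in Kraus form (so ∑_k K_k† K_k = I) from matrices on ℂ^{d_A} ⊗ ℂ^{d_B} to matrices on ℂ^{d_A'} ⊗ ℂ^{d_B'}, and suppose T(σ) is separable, i.e., T(σ) = ∑_j p_j α_j ⊗ β_j for finitely many weights p_j ≥ 0 with ∑_j p_j = 1 and density matrices α_j on ℂ^{d_A'} and β_j on ℂ^{d_B'}. Then for every positive integer M with M ≤ d_A' and M ≤ d_B' and every real γ, ⟨Ψ⁺_M| T(ρ) |Ψ⁺_M⟩ ≤ Tr[(ρ − e^{γ} σ)⁺] + e^{γ}/M. -/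
open Matrix Kronecker ComplexOrder

noncomputable section

theorem overlap_sum {n κ : Type*} [Fintype n] [Fintype κ] (ψ : n → ℂ) (X : κ → Matrix n n ℂ) :
    overlap ψ (∑ k, X k) = ∑ k, overlap ψ (X k) := by
  simp only [overlap, Matrix.sum_mulVec, dotProduct_sum]

theorem overlap_add {n : Type*} [Fintype n] (ψ : n → ℂ) (X Y : Matrix n n ℂ) :
    overlap ψ (X + Y) = overlap ψ X + overlap ψ Y := by
  simp only [overlap, Matrix.add_mulVec, dotProduct_add]

theorem overlap_smul {n : Type*} [Fintype n] (ψ : n → ℂ) (c : ℂ) (X : Matrix n n ℂ) :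
    overlap ψ (c • X) = c * overlap ψ X := by
  simp only [overlap, Matrix.smul_mulVec, dotProduct_smul, smul_eq_mul]

theorem overlap_mul_mul_conjTranspose {m n : Type*} [Fintype m] [Fintype n] (ψ : m → ℂ)
    (A : Matrix m n ℂ) (X : Matrix n n ℂ) :
    overlap ψ (A * X * Aᴴ) = overlap (Aᴴ *ᵥ ψ) X := by
  simp only [overlap, ← Matrix.mulVec_mulVec, Matrix.star_mulVec, conjTranspose_conjTranspose,
    Matrix.dotProduct_mulVec]

theorem overlap_diagonal {n : Type*} [Fintype n] [DecidableEq n] (ψ : n → ℂ) (d : n → ℝ) :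
    overlap ψ (diagonal fun i => (d i : ℂ)) = ((∑ i, d i * ‖ψ i‖ ^ 2 : ℝ) : ℂ) := by
  simp only [overlap, dotProduct, Matrix.mulVec_diagonal, Pi.star_apply]
  push_cast
  refine Finset.sum_congr rfl fun i _ => ?_
  rw [← Complex.conj_mul', ← starRingEnd_apply]
  ring

/-- Cauchy–Schwarz for complex sums. -/
theorem norm_sum_mul_sq_le {n : Type*} [Fintype n] (a b : n → ℂ) :
    ‖∑ x, a x * b x‖ ^ 2 ≤ (∑ x, ‖a x‖ ^ 2) * ∑ x, ‖b x‖ ^ 2 :=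
  calc ‖∑ x, a x * b x‖ ^ 2 ≤ (∑ x, ‖a x‖ * ‖b x‖) ^ 2 := by
        gcongr
        simpa only [norm_mul] using norm_sum_le Finset.univ fun x => a x * b x
    _ ≤ _ := Finset.sum_mul_sq_le_sq_mul_sq ..

theorem re_conjTranspose_mul_self_apply {m n : Type*} [Fintype m] (A : Matrix m n ℂ) (i : n) :
    ((Aᴴ * A) i i).re = ∑ x, ‖A x i‖ ^ 2 := by
  rw [Matrix.mul_apply, Complex.re_sum]
  refine Finset.sum_congr rfl fun x _ => ?_
  rw [conjTranspose_apply, ← starRingEnd_apply, Complex.conj_mul', ← Complex.ofReal_pow,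
    Complex.ofReal_re]

/-- A channel cannot raise the overlap with a unit vector above the trace of the positive part. -/
theorem re_overlap_map_le_posPartTrace {m n κ : Type*} [Fintype m] [Fintype n] [DecidableEq n]
    [Fintype κ] (K : κ → Matrix m n ℂ) (hK : ∑ k, (K k)ᴴ * K k = 1) {ψ : m → ℂ}
    (hψ : ∑ x, ‖ψ x‖ ^ 2 = 1) {C : Matrix n n ℂ} (hC : C.IsHermitian) :
    (overlap ψ (∑ k, K k * C * (K k)ᴴ)).re ≤ posPartTrace C := by
  set U : Matrix n n ℂ := (hC.eigenvectorUnitary : Matrix n n ℂ)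
  have hUU : Uᴴ * U = 1 := Unitary.coe_star_mul_self hC.eigenvectorUnitary
  have hspec : C = U * diagonal (fun i => (hC.eigenvalues i : ℂ)) * Uᴴ := by
    conv_lhs => rw [hC.spectral_theorem]
    rfl
  set W : κ → Matrix m n ℂ := fun k => K k * U with hW
  have hWW : ∑ k, (W k)ᴴ * W k = 1 := by
    have : ∀ k, (W k)ᴴ * W k = Uᴴ * ((K k)ᴴ * K k) * U := fun k => by
      simp only [hW, conjTranspose_mul, Matrix.mul_assoc]
    simp only [this, ← Finset.sum_mul, ← Finset.mul_sum, hK, Matrix.mul_one, hUU]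
  have hterm : ∀ k, overlap ψ (K k * C * (K k)ᴴ)
      = ((∑ i, hC.eigenvalues i * ‖((W k)ᴴ *ᵥ ψ) i‖ ^ 2 : ℝ) : ℂ) := fun k => by
    have : K k * C * (K k)ᴴ = W k * diagonal (fun i => (hC.eigenvalues i : ℂ)) * (W k)ᴴ := by
      conv_lhs => rw [hspec]
      simp only [hW, conjTranspose_mul, Matrix.mul_assoc]
    rw [this, overlap_mul_mul_conjTranspose, overlap_diagonal]
  have hweight : ∀ i, ∑ k, ‖((W k)ᴴ *ᵥ ψ) i‖ ^ 2 ≤ 1 := fun i =>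
    calc ∑ k, ‖((W k)ᴴ *ᵥ ψ) i‖ ^ 2 ≤ ∑ k, ∑ x, ‖W k x i‖ ^ 2 := by
          gcongr with k
          simpa [Matrix.mulVec, dotProduct, hψ] using norm_sum_mul_sq_le (fun x => (W k)ᴴ i x) ψ
      _ = ((∑ k, (W k)ᴴ * W k) i i).re := by
          simp only [Matrix.sum_apply, Complex.re_sum, re_conjTranspose_mul_self_apply]
      _ = 1 := by simp [hWW]
  rw [overlap_sum, Complex.re_sum, posPartTrace, dif_pos hC]
  simp only [hterm, Complex.ofReal_re]
  rw [Finset.sum_comm]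
  refine Finset.sum_le_sum fun i _ => ?_
  rw [← Finset.mul_sum]
  calc hC.eigenvalues i * ∑ k, ‖((W k)ᴴ *ᵥ ψ) i‖ ^ 2
      ≤ max (hC.eigenvalues i) 0 * ∑ k, ‖((W k)ᴴ *ᵥ ψ) i‖ ^ 2 := by
        gcongr
        exact le_max_left _ _
    _ ≤ max (hC.eigenvalues i) 0 * 1 := by
        gcongr
        exact hweight i
    _ = _ := mul_one _

open scoped MatrixOrder in
theorem Matrix.PosSemidef.norm_apply_sq_le {n : Type*} [Fintype n] {A : Matrix n n ℂ}
    (hA : A.PosSemidef) (i j : n) : ‖A i j‖ ^ 2 ≤ (A i i).re * (A j j).re := by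
  classical
  obtain ⟨B, rfl⟩ := CStarAlgebra.nonneg_iff_eq_star_mul_self.mp hA.nonneg
  rw [star_eq_conjTranspose, re_conjTranspose_mul_self_apply, re_conjTranspose_mul_self_apply]
  simpa [Matrix.mul_apply] using norm_sum_mul_sq_le (fun x => Bᴴ i x) (fun x => B x j)

theorem Matrix.PosSemidef.sum_norm_sq_le {n : Type*} [Fintype n] {A : Matrix n n ℂ}
    (hA : A.PosSemidef) : ∑ i, ∑ j, ‖A i j‖ ^ 2 ≤ A.trace.re ^ 2 :=
  calc ∑ i, ∑ j, ‖A i j‖ ^ 2 ≤ ∑ i, ∑ j, (A i i).re * (A j j).re :=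
        Finset.sum_le_sum fun i _ => Finset.sum_le_sum fun j _ => hA.norm_apply_sq_le i j
    _ = A.trace.re ^ 2 := by
        simp only [Matrix.trace, Matrix.diag, Complex.re_sum, sq, Finset.sum_mul_sum]

theorem Matrix.PosSemidef.sum_submatrix_norm_sq_le {m n : Type*} [Fintype m] [Fintype n]
    {A : Matrix n n ℂ} (hA : A.PosSemidef) {e : m → n} (he : Function.Injective e) :
    ∑ i, ∑ j, ‖A (e i) (e j)‖ ^ 2 ≤ A.trace.re ^ 2 := by
  classical
  refine le_trans ?_ hA.sum_norm_sq_le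
  rw [← Fintype.sum_prod_type', ← Fintype.sum_prod_type']
  refine (Finset.sum_image (f := fun x : n × n => ‖A x.1 x.2‖ ^ 2)
    (he.prodMap he).injOn).symm.le.trans ?_
  exact Finset.sum_le_univ_sum_of_nonneg fun _ => by positivity

theorem maxEnt_eq_sum {dA dB M : ℕ} (hA : M ≤ dA) (hB : M ≤ dB) :
    maxEnt dA dB M = ∑ i : Fin M,
      Pi.single (Fin.castLE hA i, Fin.castLE hB i) ((Real.sqrt M : ℂ))⁻¹ := by
  ext ⟨a, b⟩
  simp only [maxEnt, Finset.sum_apply, Pi.single_apply, Prod.mk.injEq, Fin.ext_iff, Fin.val_castLE]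
  split_ifs with h
  · rw [Finset.sum_eq_single ⟨a, h.2⟩]
    · simp [h.1]
    · intro i _ hi
      exact if_neg fun h' => hi (Fin.ext h'.1.symm)
    · simp
  · refine (Finset.sum_eq_zero fun i _ => if_neg fun h' => h ?_).symm
    exact ⟨h'.1.trans h'.2.symm, h'.1 ▸ i.2⟩

theorem overlap_maxEnt {dA dB M : ℕ} (hA : M ≤ dA) (hB : M ≤ dB)
    (X : Matrix (Fin dA × Fin dB) (Fin dA × Fin dB) ℂ) :
    overlap (maxEnt dA dB M) X = (M : ℂ)⁻¹ * ∑ i : Fin M, ∑ j : Fin M,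
      X (Fin.castLE hA i, Fin.castLE hB i) (Fin.castLE hA j, Fin.castLE hB j) := by
  have hs : ((Real.sqrt M : ℂ))⁻¹ * ((Real.sqrt M : ℂ))⁻¹ = (M : ℂ)⁻¹ := by
    rw [← mul_inv, ← Complex.ofReal_mul, Real.mul_self_sqrt M.cast_nonneg, Complex.ofReal_natCast]
  rw [overlap, maxEnt_eq_sum hA hB, star_sum, sum_dotProduct, Finset.mul_sum]
  refine Finset.sum_congr rfl fun i _ => ?_
  rw [Matrix.mulVec_sum, dotProduct_sum, Finset.mul_sum]
  refine Finset.sum_congr rfl fun j _ => ?_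
  rw [← Pi.single_star, single_dotProduct, Matrix.mulVec_single, ← hs]
  simp
  ring

theorem sum_norm_sq_maxEnt {dA dB M : ℕ} (hM : 0 < M) (hA : M ≤ dA) (hB : M ≤ dB) :
    ∑ x, ‖maxEnt dA dB M x‖ ^ 2 = 1 := by
  have h1 := overlap_maxEnt hA hB (diagonal fun _ => ((1 : ℝ) : ℂ))
  rw [overlap_diagonal] at h1
  have hM' : (M : ℂ) ≠ 0 := by exact_mod_cast hM.ne'
  simp only [diagonal_apply, Prod.mk.injEq, Fin.castLE_inj, and_self, Finset.sum_ite_eq,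
    Finset.mem_univ, if_true, Finset.sum_const, Finset.card_univ, Fintype.card_fin, one_mul,
    nsmul_eq_mul, Complex.ofReal_one, mul_one, inv_mul_cancel₀ hM'] at h1
  exact_mod_cast h1

/-- Product states have overlap at most `1 / M` with the maximally entangled state of rank `M`. -/
theorem re_overlap_maxEnt_kronecker_le {dA dB M : ℕ} (hA : M ≤ dA) (hB : M ≤ dB)
    {α : Matrix (Fin dA) (Fin dA) ℂ} {β : Matrix (Fin dB) (Fin dB) ℂ}
    (hα : α.PosSemidef) (hαtr : α.trace = 1) (hβ : β.PosSemidef) (hβtr : β.trace = 1) :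
    (overlap (maxEnt dA dB M) (α ⊗ₖ β)).re ≤ (M : ℝ)⁻¹ := by
  have hα2 := hα.sum_submatrix_norm_sq_le (Fin.castLE_injective hA)
  have hβ2 := hβ.sum_submatrix_norm_sq_le (Fin.castLE_injective hB)
  rw [hαtr, Complex.one_re, one_pow] at hα2
  rw [hβtr, Complex.one_re, one_pow] at hβ2
  rw [overlap_maxEnt hA hB, ← Complex.ofReal_natCast, ← Complex.ofReal_inv, Complex.re_ofReal_mul]
  refine mul_le_of_le_one_right (by positivity) ?_
  simp only [Complex.re_sum, kroneckerMap_apply]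
  calc _ ≤ ∑ i : Fin M, ∑ j : Fin M, (‖α (Fin.castLE hA i) (Fin.castLE hA j)‖ ^ 2
          + ‖β (Fin.castLE hB i) (Fin.castLE hB j)‖ ^ 2) / 2 := by
        gcongr with i _ j _
        refine (Complex.re_le_norm _).trans ?_
        rw [norm_mul]
        linarith [two_mul_le_add_sq ‖α (Fin.castLE hA i) (Fin.castLE hA j)‖
          ‖β (Fin.castLE hB i) (Fin.castLE hB j)‖]
    _ ≤ 1 := by
        simp only [← Finset.sum_div, Finset.sum_add_distrib]
        linarith

/-- If `T(X) = ∑ k, K k * X * (K k)ᴴ` is a CPTP map from matrices on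
`ℂ^dA ⊗ ℂ^dB` to matrices on `ℂ^dA' ⊗ ℂ^dB'` such that `T(σ)` is separable, then for every
`M ≤ dA'`, `M ≤ dB'` and real `γ`,
`⟨Ψ⁺_M| T(ρ) |Ψ⁺_M⟩ ≤ Tr[(ρ − e^γ σ)⁺] + e^γ / M`. -/
theorem stmt7 {dA dB dA' dB' M : ℕ} (hM : 0 < M) (hMA : M ≤ dA') (hMB : M ≤ dB')
    (ρ σ : Matrix (Fin dA × Fin dB) (Fin dA × Fin dB) ℂ)
    (hρ : ρ.PosSemidef) (hρtr : ρ.trace = 1)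
    (hσ : σ.PosSemidef) (hσtr : σ.trace = 1)
    {κ : Type*} [Fintype κ]
    (K : κ → Matrix (Fin dA' × Fin dB') (Fin dA × Fin dB) ℂ)
    (hK : ∑ k, (K k)ᴴ * K k = 1)
    {ι : Type*} [Fintype ι] (p : ι → ℝ) (hp : ∀ j, 0 ≤ p j) (hp1 : ∑ j, p j = 1)
    (α : ι → Matrix (Fin dA') (Fin dA') ℂ) (β : ι → Matrix (Fin dB') (Fin dB') ℂ)
    (hα : ∀ j, (α j).PosSemidef) (hαtr : ∀ j, (α j).trace = 1)
    (hβ : ∀ j, (β j).PosSemidef) (hβtr : ∀ j, (β j).trace = 1)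
    (hsep : ∑ k, K k * σ * (K k)ᴴ = ∑ j, (p j : ℂ) • (α j ⊗ₖ β j))
    (γ : ℝ) :
    (overlap (maxEnt dA' dB' M) (∑ k, K k * ρ * (K k)ᴴ)).re
      ≤ posPartTrace (ρ - (Real.exp γ : ℂ) • σ) + Real.exp γ / M := by
  have hC : (ρ - (Real.exp γ : ℂ) • σ).IsHermitian :=
    hρ.isHermitian.sub (by
      rw [IsHermitian, conjTranspose_smul, hσ.isHermitian.eq, ← starRingEnd_apply,
        Complex.conj_ofReal])
  have hsplit : ∑ k, K k * ρ * (K k)ᴴ = ∑ k, K k * (ρ - (Real.exp γ : ℂ) • σ) * (K k)ᴴ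
      + (Real.exp γ : ℂ) • ∑ k, K k * σ * (K k)ᴴ := by
    rw [Finset.smul_sum, ← Finset.sum_add_distrib]
    refine Finset.sum_congr rfl fun k _ => ?_
    rw [Matrix.mul_sub, Matrix.sub_mul, Matrix.mul_smul, Matrix.smul_mul, sub_add_cancel]
  have hsepBound : (overlap (maxEnt dA' dB' M) (∑ k, K k * σ * (K k)ᴴ)).re ≤ (M : ℝ)⁻¹ := by
    rw [hsep, overlap_sum, Complex.re_sum]
    simp only [overlap_smul, Complex.re_ofReal_mul]
    calc _ ≤ ∑ j, p j * (M : ℝ)⁻¹ := Finset.sum_le_sum fun j _ =>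
          mul_le_mul_of_nonneg_left
            (re_overlap_maxEnt_kronecker_le hMA hMB (hα j) (hαtr j) (hβ j) (hβtr j)) (hp j)
      _ = (M : ℝ)⁻¹ := by rw [← Finset.sum_mul, hp1, one_mul]
  rw [hsplit, overlap_add, overlap_smul, Complex.add_re, Complex.re_ofReal_mul, div_eq_mul_inv]
  exact add_le_add
    (re_overlap_map_le_posPartTrace K hK (sum_norm_sq_maxEnt hM hMA hMB) hC)
    (mul_le_mul_of_nonneg_left hsepBound (Real.exp_pos γ).le)

end
end

section
/- Let σ be a density matrix on ℂ^d, let P be a d×d complex matrix with 0 ≤ P ≤ I (both P and I − P positive semidefinite) and Tr P ≤ M for a real number M ≥ 0, and let γ be a real number. Then Tr[P σ] ≤ Tr[(σ − e^{−γ} I)⁺] + M e^{−γ}, where (·)⁺ denotes the positive part of a Hermitian matrix. -/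
open Matrix Kronecker ComplexOrder

noncomputable section

/-- Variational bound: `Tr[P C] ≤ Tr[C⁺]` for Hermitian `C` and `0 ≤ P ≤ I`. -/
theorem re_trace_mul_le_posPartTrace {n : Type*} [Fintype n] [DecidableEq n]
    {C P : Matrix n n ℂ} (hC : C.IsHermitian) (hP : P.PosSemidef)
    (hP' : ((1 : Matrix n n ℂ) - P).PosSemidef) :
    ((P * C).trace).re ≤ posPartTrace C := by
  rw [posPartTrace, dif_pos hC]
  set U : Matrix n n ℂ := (hC.eigenvectorUnitary : Matrix n n ℂ) with hU
  have hUU : Uᴴ * U = 1 := Unitary.coe_star_mul_self hC.eigenvectorUnitary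
  have hspec : C = U * diagonal (RCLike.ofReal ∘ hC.eigenvalues) * Uᴴ := by
    conv_lhs => rw [hC.spectral_theorem, Unitary.conjStarAlgAut_apply]
    rfl
  have htr : (P * C).trace = ∑ i, (Uᴴ * P * U) i i * (hC.eigenvalues i : ℂ) := by
    conv_lhs => rw [hspec]
    rw [← Matrix.mul_assoc, Matrix.trace_mul_comm, ← Matrix.mul_assoc, ← Matrix.mul_assoc]
    simp [Matrix.trace, Matrix.mul_diagonal]
  rw [htr, Complex.re_sum]
  refine Finset.sum_le_sum fun i _ => ?_
  have h0 : 0 ≤ ((Uᴴ * P * U) i i).re :=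
    (Complex.le_def.1 (hP.conjTranspose_mul_mul_same U).diag_nonneg).1
  have h1 : ((Uᴴ * P * U) i i).re ≤ 1 := by
    have h := (Complex.le_def.1 ((hP'.conjTranspose_mul_mul_same U).diag_nonneg (i := i))).1
    rw [Matrix.mul_sub, Matrix.sub_mul, Matrix.mul_one, hUU] at h
    simpa using h
  rw [Complex.re_mul_ofReal]
  calc ((Uᴴ * P * U) i i).re * hC.eigenvalues i
      ≤ ((Uᴴ * P * U) i i).re * max (hC.eigenvalues i) 0 :=
        mul_le_mul_of_nonneg_left (le_max_left _ _) h0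
    _ ≤ max (hC.eigenvalues i) 0 := mul_le_of_le_one_left (le_max_right _ _) h1

/-- For a density matrix `σ`, any `0 ≤ P ≤ I` with `Tr P ≤ M`
(`M ≥ 0` real), and any real `γ`, `Tr[P σ] ≤ Tr[(σ − e^{−γ} I)⁺] + M e^{−γ}`. -/
theorem stmt14 {d : ℕ} (σ : Matrix (Fin d) (Fin d) ℂ)
    (hσ : σ.PosSemidef) (hσtr : σ.trace = 1)
    (P : Matrix (Fin d) (Fin d) ℂ) (hP : P.PosSemidef)
    (hP' : ((1 : Matrix (Fin d) (Fin d) ℂ) - P).PosSemidef)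
    (M : ℝ) (hM : 0 ≤ M) (hPtr : (P.trace).re ≤ M) (γ : ℝ) :
    ((P * σ).trace).re
      ≤ posPartTrace (σ - (Real.exp (-γ) : ℂ) • (1 : Matrix (Fin d) (Fin d) ℂ))
        + M * Real.exp (-γ) := by
  have hC : (σ - (Real.exp (-γ) : ℂ) • (1 : Matrix (Fin d) (Fin d) ℂ)).IsHermitian := by
    refine hσ.isHermitian.sub ?_
    rw [Matrix.IsHermitian, Matrix.conjTranspose_smul, Matrix.conjTranspose_one]
    congr 1
    exact Complex.conj_ofReal _
  have h := re_trace_mul_le_posPartTrace hC hP hP'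
  rw [Matrix.mul_sub, Matrix.trace_sub, Matrix.mul_smul, Matrix.mul_one, Matrix.trace_smul,
    smul_eq_mul, Complex.sub_re, Complex.re_ofReal_mul] at h
  nlinarith [mul_le_mul_of_nonneg_right hPtr (Real.exp_pos (-γ)).le]

end
end
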